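/- arXiv:2006.10644 — 7 statements merged into one kernel-verified Lean document; each statement's English description precedes it below -/
import Mathlib

section
/- For every angle φ with 0 < φ < 2π and every real number λ with 0 < λ ≤ 1/2, one has sin²(λφ) > λ²·sin²(φ). In particular, for every corner angle φ ∈ (0,2π)\{π}, the smallest positive solution λ_φ of the corner-exponent equation sin²(λφ) = λ²·sin²(φ) satisfies λ_φ > 1/2. -/
/-- On `[0, π]`, concavity of the sine gives `t * sin x ≤ sin (t * x)` for `t ∈ [0, 1]`. -/
theorem mul_sin_le_sin_mul {t x : ℝ} (ht₀ : 0 ≤ t) (ht₁ : t ≤ 1) (hx₀ : 0 ≤ x)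
    (hx : x ≤ Real.pi) : t * Real.sin x ≤ Real.sin (t * x) := by
  have h := strictConcaveOn_sin_Icc.concaveOn.2 (x := x) (y := 0) ⟨hx₀, hx⟩
    ⟨le_rfl, Real.pi_pos.le⟩ ht₀ (sub_nonneg.2 ht₁) (add_sub_cancel t 1)
  simpa using h

/-- The strict corner inequality `lam ^ 2 * sin φ ^ 2 < sin (lam * φ) ^ 2`. -/
theorem sq_mul_sin_sq_lt_sin_mul_sq {φ lam : ℝ} (hφ₀ : 0 < φ) (hφ : φ < 2 * Real.pi)
    (h₀ : 0 < lam) (h : lam ≤ 1 / 2) :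
    lam ^ 2 * Real.sin φ ^ 2 < Real.sin (lam * φ) ^ 2 := by
  have hs : 0 < Real.sin (φ / 2) := Real.sin_pos_of_pos_of_lt_pi (by linarith) (by linarith)
  have hle : 2 * lam * Real.sin (φ / 2) ≤ Real.sin (lam * φ) := by
    have := mul_sin_le_sin_mul (t := 2 * lam) (x := φ / 2) (by linarith) (by linarith)
      (by linarith) (by linarith)
    rwa [show 2 * lam * (φ / 2) = lam * φ by ring] at this
  have hsin : Real.sin φ = 2 * Real.sin (φ / 2) * Real.cos (φ / 2) := by
    rw [← Real.sin_two_mul, mul_div_cancel₀ φ two_ne_zero]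
  have hcos : Real.cos (φ / 2) ^ 2 < 1 := by
    have := Real.sin_sq_add_cos_sq (φ / 2)
    have := pow_pos hs 2
    linarith
  calc lam ^ 2 * Real.sin φ ^ 2
      = (2 * lam * Real.sin (φ / 2)) ^ 2 * Real.cos (φ / 2) ^ 2 := by rw [hsin]; ring
    _ < (2 * lam * Real.sin (φ / 2)) ^ 2 := mul_lt_of_lt_one_right (by positivity) hcos
    _ ≤ Real.sin (lam * φ) ^ 2 := by gcongr

/-- For every angle `φ ∈ (0, 2π)` and every `λ ∈ (0, 1/2]` one has
`sin²(λφ) > λ²·sin²(φ)`; consequently, for every corner angle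
`φ ∈ (0, 2π) \ {π}`, the smallest positive solution of the corner-exponent
equation `sin²(λφ) = λ²·sin²(φ)` is larger than `1/2`. -/
theorem stokes_corner_exponent_gt_half :
    (∀ φ lam : ℝ, 0 < φ → φ < 2 * Real.pi → 0 < lam → lam ≤ 1 / 2 →
      lam ^ 2 * Real.sin φ ^ 2 < Real.sin (lam * φ) ^ 2) ∧
    (∀ φ : ℝ, 0 < φ → φ < 2 * Real.pi → φ ≠ Real.pi →
      ∀ lamφ : ℝ,
        IsLeast {lam : ℝ | 0 < lam ∧
          Real.sin (lam * φ) ^ 2 = lam ^ 2 * Real.sin φ ^ 2} lamφ →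
        1 / 2 < lamφ) := by
  refine ⟨fun φ lam hφ₀ hφ h₀ h => sq_mul_sin_sq_lt_sin_mul_sq hφ₀ hφ h₀ h, ?_⟩
  intro φ hφ₀ hφ _ lamφ hleast
  by_contra! h
  exact (sq_mul_sin_sq_lt_sin_mul_sq hφ₀ hφ hleast.1.1 h).ne' hleast.1.2
end

section
/- Let q and r be real polynomials in two variables x and y (elements of MvPolynomial (Fin 2) ℝ). If ∂q/∂x = y·r and ∂q/∂y = −x·r (i.e., ∇q + x^⊥·r = 0 with x^⊥ = (−y,x)), where ∂/∂x and ∂/∂y denote formal partial derivatives, then r = 0 and q is a constant polynomial. -/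
open MvPolynomial

theorem MvPolynomial.coeff_X_mul_pderiv {σ R : Type*} [CommSemiring R] (i : σ)
    (p : MvPolynomial σ R) (m : σ →₀ ℕ) :
    coeff m (X i * pderiv i p) = m i * coeff m p := by
  classical
  induction p using MvPolynomial.induction_on' with
  | monomial u a =>
    rw [X_mul_pderiv_monomial, coeff_smul, coeff_monomial, nsmul_eq_mul]
    split_ifs with h
    · rw [h]
    · simp
  | add p q hp hq => simp only [map_add, mul_add, coeff_add, hp, hq]

/-- In characteristic zero, the kernel of the Euler operator consists of the constants. -/
theorem MvPolynomial.eq_C_of_sum_X_mul_pderiv_eq_zero {σ R : Type*} [Fintype σ]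
    [CommSemiring R] [NoZeroDivisors R] [CharZero R] {p : MvPolynomial σ R}
    (h : ∑ i, X i * pderiv i p = 0) : p = C (coeff 0 p) := by
  classical
  ext m
  rw [coeff_C]
  split_ifs with hm
  · rw [hm]
  · have key := congrArg (coeff m) h
    simp only [coeff_sum, coeff_X_mul_pderiv, coeff_zero, ← Finset.sum_mul] at key
    refine (mul_eq_zero.mp key).resolve_left fun h0 => hm ?_
    have h1 : ∑ i, m i = 0 := by exact_mod_cast h0
    ext i
    exact (Finset.sum_eq_zero_iff.mp h1 i (Finset.mem_univ i)).symm

/-- If `∇q + x^⊥·r = 0` with `x^⊥ = (−y, x)`, i.e. `∂q/∂x = y·r` and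
`∂q/∂y = −x·r`, for real polynomials `q, r` in two variables, then `r = 0`
and `q` is a constant polynomial. -/
theorem grad_add_xperp_eq_zero (q r : MvPolynomial (Fin 2) ℝ)
    (hx : pderiv 0 q = X 1 * r) (hy : pderiv 1 q = -(X 0 * r)) :
    r = 0 ∧ ∃ c : ℝ, q = C c := by
  have hq : q = C (coeff 0 q) := by
    apply eq_C_of_sum_X_mul_pderiv_eq_zero
    rw [Fin.sum_univ_two, hx, hy]
    ring
  refine ⟨?_, _, hq⟩
  rw [hq, pderiv_C] at hx
  exact (mul_eq_zero.mp hx.symm).resolve_left (X_ne_zero 1)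
end

section
/- Let p ≥ 1 be a natural number and let f, g be real polynomials in two variables x and y (elements of MvPolynomial (Fin 2) ℝ) of total degree at most p. Then there exist real polynomials q of total degree at most p+1 and r of total degree at most p−1 such that f = ∂q/∂x − y·r and g = ∂q/∂y + x·r, where ∂/∂x and ∂/∂y denote formal partial derivatives. That is, every ℝ²-valued polynomial of degree at most p decomposes as ∇q + x^⊥·r with x^⊥ = (−y,x). -/
open MvPolynomial

/-- A homogeneous planar polynomial vector field `(f, g)` of degree `n` is `∇q + x^⊥·r` with
`(n + 1) q = x f + y g` and `(n + 1) r = ∂g/∂x - ∂f/∂y`. -/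
theorem MvPolynomial.IsHomogeneous.exists_gradient_add_xperp {K : Type*} [Field K] [CharZero K]
    {n : ℕ} {f g : MvPolynomial (Fin 2) K} (hf : f.IsHomogeneous n) (hg : g.IsHomogeneous n) :
    ∃ q r : MvPolynomial (Fin 2) K,
      q.IsHomogeneous (n + 1) ∧ r.IsHomogeneous (n - 1) ∧
      f = pderiv 0 q - X 1 * r ∧ g = pderiv 1 q + X 0 * r := by
  have hC : (C ((n + 1 : K)⁻¹) : MvPolynomial (Fin 2) K) *
      ((n : MvPolynomial (Fin 2) K) + 1) = 1 := by
    have h : (n + 1 : K) ≠ 0 := Nat.cast_add_one_ne_zero n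
    simpa only [map_mul, map_add, map_natCast, map_one] using
      congrArg (C : K →+* MvPolynomial (Fin 2) K) (inv_mul_cancel₀ h)
  have ef := hf.sum_X_mul_pderiv
  have eg := hg.sum_X_mul_pderiv
  simp only [Fin.sum_univ_two, nsmul_eq_mul] at ef eg
  refine ⟨C ((n + 1 : K)⁻¹) * (X 0 * f + X 1 * g),
    C ((n + 1 : K)⁻¹) * (pderiv 0 g - pderiv 1 f), ?_, ?_, ?_, ?_⟩
  · rw [add_comm n 1]
    exact (((isHomogeneous_X K 0).mul hf).add ((isHomogeneous_X K 1).mul hg)).C_mul _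
  · exact (hg.pderiv.sub hf.pderiv).C_mul _
  · rw [pderiv_C_mul, map_add, pderiv_mul, pderiv_mul, pderiv_X_self,
      pderiv_X_of_ne (by decide : (1 : Fin 2) ≠ 0)]
    linear_combination (-f) * hC - C ((n + 1 : K)⁻¹) * ef
  · rw [pderiv_C_mul, map_add, pderiv_mul, pderiv_mul, pderiv_X_self,
      pderiv_X_of_ne (by decide : (0 : Fin 2) ≠ 1)]
    linear_combination (-g) * hC - C ((n + 1 : K)⁻¹) * eg

/-- A polynomial of total degree at most `p` is the sum of its homogeneous components of degree at
most `p`. -/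
theorem MvPolynomial.sum_range_homogeneousComponent {σ R : Type*} [CommSemiring R]
    {f : MvPolynomial σ R} {p : ℕ} (hf : f.totalDegree ≤ p) :
    ∑ i ∈ Finset.range (p + 1), homogeneousComponent i f = f := by
  conv_rhs => rw [← sum_homogeneousComponent f]
  refine (Finset.sum_subset (Finset.range_mono (by omega)) fun i _ hi => ?_).symm
  exact homogeneousComponent_eq_zero i f (by simpa using hi)

/-- Every `ℝ²`-valued polynomial `(f, g)` of total degree at most `p ≥ 1`
decomposes as `∇q + x^⊥·r` with `x^⊥ = (−y, x)`, where `q` has total degree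
at most `p + 1` and `r` has total degree at most `p − 1`. -/
theorem polynomial_gradient_xperp_decomposition (p : ℕ) (hp : 1 ≤ p)
    (f g : MvPolynomial (Fin 2) ℝ)
    (hf : f.totalDegree ≤ p) (hg : g.totalDegree ≤ p) :
    ∃ q r : MvPolynomial (Fin 2) ℝ,
      q.totalDegree ≤ p + 1 ∧ r.totalDegree ≤ p - 1 ∧
      f = pderiv 0 q - X 1 * r ∧ g = pderiv 1 q + X 0 * r := by
  choose q r hq hr hfq hgq using fun i =>
    (homogeneousComponent_isHomogeneous i f).exists_gradient_add_xperp
      (homogeneousComponent_isHomogeneous i g)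
  refine ⟨∑ i ∈ Finset.range (p + 1), q i, ∑ i ∈ Finset.range (p + 1), r i, ?_, ?_, ?_, ?_⟩
  · refine totalDegree_finsetSum_le fun i hi => (hq i).totalDegree_le.trans ?_
    have := Finset.mem_range.mp hi
    omega
  · refine totalDegree_finsetSum_le fun i hi => (hr i).totalDegree_le.trans ?_
    have := Finset.mem_range.mp hi
    omega
  · rw [map_sum, Finset.mul_sum, ← Finset.sum_sub_distrib, ← Finset.sum_congr rfl fun i _ => hfq i,
      sum_range_homogeneousComponent hf]
  · rw [map_sum, Finset.mul_sum, ← Finset.sum_add_distrib, ← Finset.sum_congr rfl fun i _ => hgq i,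
      sum_range_homogeneousComponent hg]
end

section
/- Let V and Q be real Hilbert spaces, let B : V → Q be a continuous linear map, and let β > 0 be such that β·‖q‖ ≤ ‖B* q‖ for all q ∈ Q, where B* denotes the Hilbert adjoint of B (this is the inf-sup condition for the bilinear form (v,q) ↦ ⟨B v, q⟩). If w ∈ V and s ∈ Q satisfy ⟨w, v⟩_V + ⟨B v, s⟩_Q = 0 for all v ∈ V, then β·‖w‖ ≤ ‖B w‖. -/
open RealInnerProductSpace

/-- Abstract stability estimate for the local constrained Stokes problem: if
`B : V → Q` is a continuous linear map between real Hilbert spaces whose adjoint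
satisfies the inf-sup bound `β‖q‖ ≤ ‖B* q‖`, and `(w, s)` satisfies
`⟨w, v⟩ + ⟨B v, s⟩ = 0` for all `v`, then `β‖w‖ ≤ ‖B w‖`. -/
theorem constrained_stokes_stability
    {V Q : Type*} [NormedAddCommGroup V] [InnerProductSpace ℝ V] [CompleteSpace V]
    [NormedAddCommGroup Q] [InnerProductSpace ℝ Q] [CompleteSpace Q]
    (B : V →L[ℝ] Q) (β : ℝ) (hβ : 0 < β)
    (hinf : ∀ q : Q, β * ‖q‖ ≤ ‖ContinuousLinearMap.adjoint B q‖)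
    (w : V) (s : Q) (h : ∀ v : V, ⟪w, v⟫ + ⟪B v, s⟫ = 0) :
    β * ‖w‖ ≤ ‖B w‖ := by
  have hw : w = -ContinuousLinearMap.adjoint B s := by
    refine ext_inner_right ℝ fun v => ?_
    rw [inner_neg_left, ContinuousLinearMap.adjoint_inner_left]
    linarith [h v, real_inner_comm (B v) s]
  have hs : β * ‖s‖ ≤ ‖w‖ := by
    rw [hw, norm_neg]
    exact hinf s
  have hsq : ‖w‖ * ‖w‖ ≤ ‖B w‖ * ‖s‖ := by
    rw [← real_inner_self_eq_norm_mul_norm]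
    linarith [h w, neg_le_of_abs_le (abs_real_inner_le_norm (B w) s)]
  rcases (norm_nonneg w).eq_or_lt with hw0 | hw0
  · simp [← hw0]
  · refine le_of_mul_le_mul_right ?_ hw0
    calc β * ‖w‖ * ‖w‖ = β * (‖w‖ * ‖w‖) := by ring
      _ ≤ β * (‖B w‖ * ‖s‖) := by gcongr
      _ = ‖B w‖ * (β * ‖s‖) := by ring
      _ ≤ ‖B w‖ * ‖w‖ := by gcongr
end

section
/- Let H be a real inner product space, let W ⊆ H be a finite-dimensional subspace, let Q be a finite-dimensional real normed space, and let b : H × Q → ℝ be a bilinear form satisfying |b(v,q)| ≤ ‖v‖·‖q‖ for all v ∈ H, q ∈ Q. Assume there exists β > 0 such that for every q ∈ Q there exists w ∈ W with w ≠ 0 and β·‖q‖·‖w‖ ≤ b(w,q) (discrete inf-sup condition). Define Z := { w ∈ W : b(w,q) = 0 for all q ∈ Q }. Then for every u ∈ H with b(u,q) = 0 for all q ∈ Q and every v ∈ W, there exists z ∈ Z such that ‖u − z‖ ≤ (1 + 1/β)·‖u − v‖. -/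
/-- A linear functional vanishing on the kernel of `f : V → Dual K Q` with `Q` finite-dimensional
is of the form `w ↦ f w q`. -/
theorem exists_apply_eq_of_ker_le_ker {K V Q : Type*} [Field K] [AddCommGroup V] [Module K V]
    [AddCommGroup Q] [Module K Q] [FiniteDimensional K Q]
    (f : V →ₗ[K] Module.Dual K Q) (φ : Module.Dual K V) (h : LinearMap.ker f ≤ LinearMap.ker φ) :
    ∃ q : Q, ∀ w : V, φ w = f w q := by
  have hφ : φ ∈ LinearMap.range f.dualMap := by
    rw [LinearMap.range_dualMap_eq_dualAnnihilator_ker, Submodule.mem_dualAnnihilator]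
    exact fun w hw => h hw
  obtain ⟨ψ, rfl⟩ := hφ
  obtain ⟨q, rfl⟩ := (Module.evalEquiv K Q).surjective ψ
  exact ⟨q, fun w => rfl⟩

/-- Best approximation in the discrete kernel: if `b` is a bounded bilinear
form satisfying the discrete inf-sup condition on a finite-dimensional subspace
`W` with constant `β > 0`, then for every `u` with `b(u, q) = 0` for all `q`
and every `v ∈ W`, there exists `z` in the discrete kernel
`Z = {w ∈ W | b(w, q) = 0 ∀q}` with `‖u − z‖ ≤ (1 + 1/β)‖u − v‖`. -/
theorem kernel_best_approximation
    {H Q : Type*} [NormedAddCommGroup H] [InnerProductSpace ℝ H]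
    [NormedAddCommGroup Q] [NormedSpace ℝ Q] [FiniteDimensional ℝ Q]
    (W : Submodule ℝ H) [FiniteDimensional ℝ W]
    (b : H →ₗ[ℝ] Q →ₗ[ℝ] ℝ) (hb : ∀ (v : H) (q : Q), |b v q| ≤ ‖v‖ * ‖q‖)
    (β : ℝ) (hβ : 0 < β)
    (hinf : ∀ q : Q, ∃ w : H, w ∈ W ∧ w ≠ 0 ∧ β * ‖q‖ * ‖w‖ ≤ b w q)
    (u : H) (hu : ∀ q : Q, b u q = 0) (v : H) (hv : v ∈ W) :
    ∃ z : H, z ∈ W ∧ (∀ q : Q, b z q = 0) ∧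
      ‖u - z‖ ≤ (1 + 1 / β) * ‖u - v‖ := by
  let f : W →ₗ[ℝ] Module.Dual ℝ Q := b ∘ₗ W.subtype
  let v' : W := ⟨v, hv⟩
  let z : W := (LinearMap.ker f).starProjection v'
  have hz : f z = 0 := (LinearMap.ker f).starProjection_apply_mem v'
  have hzq (q : Q) : b z q = 0 := DFunLike.congr_fun hz q
  obtain ⟨q, hq⟩ := exists_apply_eq_of_ker_le_ker f (innerₗ W (z - v')) fun w hw => by
    have := (LinearMap.ker f).starProjection_inner_eq_zero v' w hw
    rw [LinearMap.mem_ker, innerₗ_apply_apply, ← neg_sub, inner_neg_left, this, neg_zero]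
  have hq_norm : β * ‖q‖ ≤ ‖z - v'‖ := by
    obtain ⟨w, hwW, hw0, hw⟩ := hinf q
    refine le_of_mul_le_mul_right (hw.trans ?_) (norm_pos_iff.mpr hw0)
    calc b w q = inner ℝ (z - v') (⟨w, hwW⟩ : W) := (hq ⟨w, hwW⟩).symm
      _ ≤ ‖z - v'‖ * ‖w‖ := real_inner_le_norm _ _
  have hsq : ‖z - v'‖ ^ 2 ≤ ‖u - v‖ * ‖q‖ := by
    calc ‖z - v'‖ ^ 2 = inner ℝ (z - v') (z - v') := (real_inner_self_eq_norm_sq _).symm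
      _ = b (z - v) q := hq (z - v')
      _ = b (u - v) q := by simp [hzq, hu]
      _ ≤ ‖u - v‖ * ‖q‖ := (le_abs_self _).trans (hb _ _)
  have hr : β * ‖z - v'‖ ≤ ‖u - v‖ := by
    rcases (norm_nonneg (z - v')).eq_or_lt with h0 | hpos
    · rw [← h0, mul_zero]
      exact norm_nonneg _
    · refine le_of_mul_le_mul_right ?_ hpos
      calc β * ‖z - v'‖ * ‖z - v'‖ = β * ‖z - v'‖ ^ 2 := by ring
        _ ≤ β * (‖u - v‖ * ‖q‖) := by gcongr
        _ = ‖u - v‖ * (β * ‖q‖) := by ring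
        _ ≤ ‖u - v‖ * ‖z - v'‖ := by gcongr
  refine ⟨z, z.2, hzq, ?_⟩
  calc ‖u - z‖ = ‖(u - v) - (z - v)‖ := by rw [sub_sub_sub_cancel_right]
    _ ≤ ‖u - v‖ + ‖z - v'‖ := norm_sub_le _ _
    _ ≤ ‖u - v‖ + ‖u - v‖ / β := by
      gcongr
      rwa [le_div_iff₀' hβ]
    _ = (1 + 1 / β) * ‖u - v‖ := by ring
end

section
/- Let H be a real inner product space, let W ⊆ H and P ⊆ H be subspaces, and let a_n : H × H → ℝ be a bilinear form. Let 0 < α₁ ≤ 1 ≤ α₂ and F ≥ 0 be real numbers such that: (i) α₁·‖w‖² ≤ a_n(w,w) for all w ∈ W; (ii) a_n(v,w) ≤ α₂·‖v‖·‖w‖ for all v ∈ H and w ∈ W; (iii) a_n(p,w) = ⟨p,w⟩ for all p ∈ P and w ∈ W (consistency); and (iv) u ∈ H and u_n ∈ W satisfy |⟨u,w⟩ − a_n(u_n,w)| ≤ F·‖w‖ for all w ∈ W (residual bound). Then for every z ∈ W and every p ∈ P: ‖u − u_n‖ ≤ (1/α₁)·( F + (α₂ + 1)·( ‖u − z‖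 + ‖u − p‖ ) ). -/
open RealInnerProductSpace

/-- Abstract Strang-type a priori estimate for the velocity: under coercivity
(with constant `α₁`), continuity (with constant `α₂`), polynomial consistency
and a residual bound `F` for the discrete bilinear form `a_n`, the error
satisfies `‖u − u_n‖ ≤ (1/α₁)(F + (α₂ + 1)(‖u − z‖ + ‖u − p‖))` for all
`z ∈ W` and `p ∈ P`. -/
theorem strang_velocity_estimate
    {H : Type*} [NormedAddCommGroup H] [InnerProductSpace ℝ H]
    (W P : Submodule ℝ H) (an : H →ₗ[ℝ] H →ₗ[ℝ] ℝ)
    (α₁ α₂ F : ℝ) (hα₁ : 0 < α₁) (hα₁' : α₁ ≤ 1) (hα₂ : 1 ≤ α₂) (hF : 0 ≤ F)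
    (hcoer : ∀ w ∈ W, α₁ * ‖w‖ ^ 2 ≤ an w w)
    (hcont : ∀ v : H, ∀ w ∈ W, an v w ≤ α₂ * ‖v‖ * ‖w‖)
    (hcons : ∀ p ∈ P, ∀ w ∈ W, an p w = ⟪p, w⟫)
    (u un : H) (hun : un ∈ W)
    (hres : ∀ w ∈ W, |⟪u, w⟫ - an un w| ≤ F * ‖w‖) :
    ∀ z ∈ W, ∀ p ∈ P,
      ‖u - un‖ ≤ (1 / α₁) * (F + (α₂ + 1) * (‖u - z‖ + ‖u - p‖)) := by
  intro z hz p hp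
  have hw : z - un ∈ W := W.sub_mem hz hun
  have hsplit : an (z - un) (z - un)
      = an (z - p) (z - un) + ⟪p - u, z - un⟫ + (⟪u, z - un⟫ - an un (z - un)) := by
    have hp' := hcons p hp _ hw
    rw [map_sub an z un, map_sub an z p, LinearMap.sub_apply, LinearMap.sub_apply, hp',
      inner_sub_left]
    ring
  have henergy : α₁ * ‖z - un‖ * ‖z - un‖
      ≤ (α₂ * ‖z - p‖ + ‖u - p‖ + F) * ‖z - un‖ := by
    have h₁ := hcont (z - p) _ hw
    have h₂ := real_inner_le_norm (p - u) (z - un)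
    have h₃ := (le_abs_self _).trans (hres _ hw)
    have h₄ := hcoer _ hw
    rw [norm_sub_rev p u] at h₂
    linarith
  have hdiscrete : α₁ * ‖z - un‖ ≤ α₂ * ‖z - p‖ + ‖u - p‖ + F := by
    rcases (norm_nonneg (z - un)).eq_or_lt with h | h
    · rw [← h, mul_zero]
      positivity
    · exact le_of_mul_le_mul_right henergy h
  have hzp : ‖z - p‖ ≤ ‖u - z‖ + ‖u - p‖ := by
    simpa only [norm_sub_rev z u] using norm_sub_le_norm_sub_add_norm_sub z u p
  have hαzp : α₂ * ‖z - p‖ ≤ α₂ * (‖u - z‖ + ‖u - p‖) := by gcongr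
  have htri : α₁ * ‖u - un‖ ≤ α₁ * (‖u - z‖ + ‖z - un‖) := by
    gcongr
    exact norm_sub_le_norm_sub_add_norm_sub u z un
  have hα : α₁ * ‖u - z‖ ≤ ‖u - z‖ := mul_le_of_le_one_left (norm_nonneg _) hα₁'
  rw [one_div_mul_eq_div, le_div_iff₀ hα₁]
  linarith
end

section
/- Let H be a real inner product space, let Q be a real normed space, let W ⊆ H and Q_n ⊆ Q be subspaces, and let b : H × Q → ℝ be a bilinear form with |b(v,q)| ≤ ‖v‖·‖q‖ for all v ∈ H and q ∈ Q. Assume there exists β > 0 such that for every q_n ∈ Q_n there exists w ∈ W with w ≠ 0 and β·‖q_n‖·‖w‖ ≤ b(w, q_n) (discrete inf-sup condition). Let s ∈ Q, s_n ∈ Q_n and R ≥ 0 be such that |b(w, s − s_n)| ≤ R·‖w‖ for all w ∈ W. Then for every q_n ∈ Q_n: ‖s − s_n‖ ≤ (1/β)·( R + (1 + β)·‖s − q_n‖ ). -/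
/-- Abstract a priori estimate on the pressure: if the bounded bilinear form
`b` satisfies the discrete inf-sup condition on `W × Q_n` with constant
`β > 0` and the residual bound `|b(w, s − s_n)| ≤ R‖w‖` holds on `W`, then
`‖s − s_n‖ ≤ (1/β)(R + (1 + β)‖s − q_n‖)` for all `q_n ∈ Q_n`. -/
theorem pressure_apriori_estimate
    {H Q : Type*} [NormedAddCommGroup H] [InnerProductSpace ℝ H]
    [NormedAddCommGroup Q] [NormedSpace ℝ Q]
    (W : Submodule ℝ H) (Qn : Submodule ℝ Q)
    (b : H →ₗ[ℝ] Q →ₗ[ℝ] ℝ) (hb : ∀ (v : H) (q : Q), |b v q| ≤ ‖v‖ * ‖q‖)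
    (β : ℝ) (hβ : 0 < β)
    (hinf : ∀ qn ∈ Qn, ∃ w ∈ W, w ≠ 0 ∧ β * ‖qn‖ * ‖w‖ ≤ b w qn)
    (s : Q) (sn : Q) (hsn : sn ∈ Qn) (R : ℝ) (hR : 0 ≤ R)
    (hres : ∀ w ∈ W, |b w (s - sn)| ≤ R * ‖w‖) :
    ∀ qn ∈ Qn, ‖s - sn‖ ≤ (1 / β) * (R + (1 + β) * ‖s - qn‖) := by
  intro qn hqn
  obtain ⟨w, hw, hw0, hinfw⟩ := hinf (sn - qn) (Qn.sub_mem hsn hqn)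
  have hsplit : b w (sn - qn) = b w (s - qn) - b w (s - sn) := by
    rw [← map_sub, sub_sub_sub_cancel_left]
  have hdisc : β * ‖sn - qn‖ ≤ R + ‖s - qn‖ := by
    refine le_of_mul_le_mul_right ?_ (norm_pos_iff.mpr hw0)
    linarith [le_of_abs_le (hb w (s - qn)), neg_le_of_abs_le (hres w hw)]
  have htri : ‖s - sn‖ ≤ ‖s - qn‖ + ‖sn - qn‖ := by
    simpa only [norm_sub_rev qn sn] using norm_sub_le_norm_sub_add_norm_sub s qn sn
  rw [one_div_mul_eq_div, le_div_iff₀' hβ]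
  linarith [mul_le_mul_of_nonneg_left htri hβ.le]
end
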